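/- Assume the abc conjecture. Let n ≥ 2 be an integer, let f ∈ ℤ[X] be squarefree (in ℚ[X]), write deg f = nk + i with k ≥ 0 and 1 ≤ i ≤ n, and set e = nk + i − 1 − (gcd(n,i)+1)/(n−1); assume e > 0. Then for every ε > 0 there exists K > 0 such that for all real X ≥ 2, the number of n-th power free integers d with |d| ≤ X for which there exist x, y ∈ ℚ with y ≠ 0 and d·y^n = f(x) is at most K·X^{2/e + ε}. -/

import Mathlib

open Polynomial

/-- The radical of an integer: the product of its distinct prime factors. -/
def IntRadical (m : ℤ) : ℕ := ∏ p ∈ m.natAbs.primeFactors, p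

/-- The abc conjecture of Masser–Oesterlé. -/
def ABCConjecture : Prop :=
  ∀ ε : ℝ, 0 < ε → ∃ K : ℝ, 0 < K ∧ ∀ a b c : ℤ,
    a ≠ 0 → b ≠ 0 → c ≠ 0 →
    IsCoprime a b → IsCoprime a c → IsCoprime b c →
    a + b = c →
    ((max (max |a| |b|) |c| : ℤ) : ℝ) ≤ K * (IntRadical (a * b * c) : ℝ) ^ (1 + ε)

/-- `d` is `n`-th power free. -/
def NthPowerFree (n : ℕ) (d : ℤ) : Prop :=
  d ≠ 0 ∧ ∀ p : ℕ, p.Prime → ¬ ((p : ℤ) ^ n ∣ d)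

/-- A `K`-point of the twist `C_d : d·y^n = f(x)`. -/
def HasTwistPoint (n : ℕ) (f : Polynomial ℤ) (d : ℤ) (K : Type) [CommRing K] : Prop :=
  ∃ x y : K, (d : K) * y ^ n = Polynomial.aeval x f

/-- The twist `C_d : d·y^n = f(x)` has points everywhere locally. -/
def EverywhereLocallySoluble (n : ℕ) (f : Polynomial ℤ) (d : ℤ) : Prop :=
  HasTwistPoint n f d ℝ ∧ ∀ (p : ℕ) (_ : Fact p.Prime), HasTwistPoint n f d ℚ_[p]

/-- The twist `C_d` violates the Hasse principle. -/
def ViolatesHasse (n : ℕ) (f : Polynomial ℤ) (d : ℤ) : Prop :=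
  EverywhereLocallySoluble n f d ∧ ¬ HasTwistPoint n f d ℚ

/-- `f` is weakly intersective: the primes modulo which `f` has a root have
relative natural density `1` in the primes. -/
def WeaklyIntersective (f : Polynomial ℤ) : Prop :=
  Filter.Tendsto (fun X : ℕ =>
      (Nat.card {ℓ : ℕ // ℓ ≤ X ∧ ℓ.Prime ∧ ∃ x : ZMod ℓ, Polynomial.aeval x f = 0} : ℝ) /
      (Nat.card {ℓ : ℕ // ℓ ≤ X ∧ ℓ.Prime} : ℝ))
    Filter.atTop (nhds 1)

theorem exists_comp_critical {K : Type*} [Field K] [Algebra ℚ K] {p g : ℚ[X]} {S : Set K} {T U : Set K}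
    (hp : p.natDegree ≠ 0) (hg : g.natDegree ≠ 0)
    (hpS : ∀ s ∈ S, aeval s p ∈ T) (hpc : ∀ z : K, aeval z (derivative p) = 0 → aeval z p ∈ T)
    (hgT : ∀ t ∈ T, aeval t g ∈ U) (hgc : ∀ z : K, aeval z (derivative g) = 0 → aeval z g ∈ U) :
    ∃ h : ℚ[X], h.natDegree ≠ 0 ∧ (∀ s ∈ S, aeval s h ∈ U) ∧
      ∀ z : K, aeval z (derivative h) = 0 → aeval z h ∈ U := by
  refine ⟨g.comp p, by simp [natDegree_comp, hp, hg], fun s hs => ?_, fun z hz => ?_⟩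
  · rw [aeval_comp]; exact hgT _ (hpS s hs)
  · rw [aeval_comp]
    rw [derivative_comp, map_mul, aeval_comp, mul_eq_zero] at hz
    rcases hz with hz | hz
    · exact hgT _ (hpc z hz)
    · exact hgc _ hz

theorem natDegree_minpoly_aeval_le {F K : Type*} [Field F] [Field K] [Algebra F K]
    [Algebra.IsAlgebraic F K] (z : K) (p : F[X]) : (minpoly F (aeval z p)).natDegree ≤ (minpoly F z).natDegree := by
  have hz : IsIntegral F z := Algebra.IsIntegral.isIntegral z
  have : FiniteDimensional F (IntermediateField.adjoin F {z}) :=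
    IntermediateField.adjoin.finiteDimensional hz
  have h := minpoly.natDegree_le (A := F) (aeval (IntermediateField.AdjoinSimple.gen F z) p)
  rw [IntermediateField.adjoin.finrank hz] at h
  rw [← minpoly.algebraMap_eq (algebraMap (IntermediateField.adjoin F {z}) K).injective, ← aeval_algebraMap_apply,
    IntermediateField.AdjoinSimple.algebraMap_gen] at h
  exact h

theorem exists_rational_critical_values {K : Type*} [Field K] [Algebra ℚ K]
    [Algebra.IsAlgebraic ℚ K] (m : ℕ) : ∀ S : Finset K,
    (∀ s ∈ S, (minpoly ℚ s).natDegree ≤ m + 1) →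
    ∃ g : ℚ[X], g.natDegree ≠ 0 ∧ (∀ s ∈ (S : Set K), aeval s g ∈ Set.range (algebraMap ℚ K)) ∧
      ∀ z : K, aeval z (derivative g) = 0 → aeval z g ∈ Set.range (algebraMap ℚ K) := by
  classical
  induction m with
  | zero =>
    intro S hS
    refine ⟨X, by simp, fun s hs => ?_, fun z hz => by simp at hz⟩
    rw [aeval_X]
    have h1 := hS s hs
    have h2 := minpoly.natDegree_pos (Algebra.IsIntegral.isIntegral (R := ℚ) s)
    exact minpoly.natDegree_eq_one_iff.mp (by omega)
  | succ m ih =>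
    intro S
    induction h : (S.filter fun s => (minpoly ℚ s).natDegree = m + 2).card
      using Nat.strong_induction_on generalizing S with
    | _ N ihN =>
    intro hS
    by_cases hall : ∀ s ∈ S, (minpoly ℚ s).natDegree ≤ m + 1
    · exact ih S hall
    push Not at hall
    obtain ⟨s, hs, hsm⟩ := hall
    have hsd : (minpoly ℚ s).natDegree = m + 2 := by have := hS s hs; omega
    set p := minpoly ℚ s with hp
    have hp' : derivative p ≠ 0 := by
      intro h0
      have := derivative_eq_zero.mp h0
      omega
    have hcrit : ∀ z : K, aeval z (derivative p) = 0 →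
        (minpoly ℚ (aeval z p)).natDegree ≤ m + 1 := fun z hz => by
      refine (natDegree_minpoly_aeval_le z p).trans ?_
      have h1 := natDegree_le_of_dvd (minpoly.dvd ℚ z hz) hp'
      have h2 := natDegree_derivative_lt (p := p) (by omega)
      omega
    let S' : Finset K := S.image (fun z => aeval z p) ∪
      ((derivative p).aroots K).toFinset.image (fun z => aeval z p)
    have hS' : ∀ t ∈ S', (∃ z ∈ S, aeval z p = t) ∨ (minpoly ℚ t).natDegree ≤ m + 1 := by
      intro t ht
      rcases Finset.mem_union.mp ht with ht | ht
      · exact Or.inl (by simpa using ht)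
      · obtain ⟨z, hz, rfl⟩ := Finset.mem_image.mp ht
        exact Or.inr (hcrit z (by simpa [hp'] using hz))
    have hdeg : ∀ t ∈ S', (minpoly ℚ t).natDegree ≤ m + 1 + 1 := by
      intro t ht
      rcases hS' t ht with ⟨z, hz, rfl⟩ | h
      · exact (natDegree_minpoly_aeval_le z p).trans (hS z hz)
      · omega
    have hlt : (S'.filter fun s => (minpoly ℚ s).natDegree = m + 2).card < N := by
      rw [← h]
      have hsub : (S'.filter fun s => (minpoly ℚ s).natDegree = m + 2) ⊆
          ((S.filter fun s => (minpoly ℚ s).natDegree = m + 2).erase s).image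
            (fun z => aeval z p) := by
        intro t ht
        obtain ⟨ht, htd⟩ := Finset.mem_filter.mp ht
        rcases hS' t ht with ⟨z, hz, rfl⟩ | h
        · refine Finset.mem_image.mpr ⟨z, ?_, rfl⟩
          have h1 := natDegree_minpoly_aeval_le z p
          have h2 := hS z hz
          refine Finset.mem_erase.mpr ⟨?_, Finset.mem_filter.mpr ⟨hz, by omega⟩⟩
          rintro rfl
          rw [hp, minpoly.aeval, minpoly.zero, natDegree_X] at htd
          omega
        · omega
      exact (Finset.card_le_card hsub).trans_lt (Finset.card_image_le.trans_lt
        (Finset.card_erase_lt_of_mem (Finset.mem_filter.mpr ⟨hs, hsd⟩)))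
    obtain ⟨g, hg, hgS, hgc⟩ := ihN _ hlt S' rfl hdeg
    refine exists_comp_critical (p := p) (by omega) hg (T := S') ?_ ?_ hgS hgc
    · exact fun z hz => Finset.mem_coe.mpr
        (Finset.mem_union_left _ (Finset.mem_image_of_mem _ hz))
    · exact fun z hz => Finset.mem_coe.mpr (Finset.mem_union_right _
        (Finset.mem_image_of_mem _ (by simpa [hp'] using hz)))

/-- Belyi's polynomial `c (X - a)^m (b - X)^n`, whose critical values are `0` and `1`. -/
theorem exists_belyi_step {K : Type*} [Field K] [Algebra ℚ K] {a r b : ℚ}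
    (har : a < r) (hrb : r < b) :
    ∃ q : ℚ[X], q.natDegree ≠ 0 ∧ q.eval a = 0 ∧ q.eval b = 0 ∧ q.eval r = 1 ∧
      ∀ z : K, aeval z (derivative q) = 0 → aeval z q = 0 ∨ aeval z q = 1 := by
  have hra : 0 < r - a := sub_pos.mpr har
  have hbr : 0 < b - r := sub_pos.mpr hrb
  obtain ⟨m, n, hmn⟩ : ∃ m n : ℕ, ((m + 1 : ℕ) : ℚ) * (b - r) = (n + 1 : ℕ) * (r - a) := by
    set t := (r - a) / (b - r) with ht
    have htpos : 0 < t := div_pos hra hbr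
    have hnum : 0 < t.num := Rat.num_pos.mpr htpos
    refine ⟨t.num.toNat - 1, t.den - 1, ?_⟩
    have h1 : t.num.toNat - 1 + 1 = t.num.toNat := by omega
    have h2 : t.den - 1 + 1 = t.den := by have := t.den_pos; omega
    rw [h1, h2]
    have h3 : ((t.num.toNat : ℕ) : ℚ) = t.num := by
      have : ((t.num.toNat : ℕ) : ℤ) = t.num := Int.toNat_of_nonneg hnum.le
      exact_mod_cast this
    have h4 : (t.num : ℚ) = t * t.den := (Rat.mul_den_eq_num t).symm
    rw [h3, h4, ht]
    field_simp
  set c : ℚ := ((r - a) ^ (m + 1) * (b - r) ^ (n + 1))⁻¹ with hc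
  have hc0 : c ≠ 0 := by positivity
  set q : ℚ[X] := C c * ((X - C a) ^ (m + 1) * (C b - X) ^ (n + 1)) with hq
  have hqa : q.eval a = 0 := by simp [hq]
  have hqr : q.eval r = 1 := by
    simp only [hq, eval_mul, eval_C, eval_pow, eval_sub, eval_X, hc]
    exact inv_mul_cancel₀ (by positivity)
  have hder : derivative q = C c * ((X - C a) ^ m * (C b - X) ^ n *
      (C ((m + 1 : ℕ) : ℚ) * (C b - X) - C ((n + 1 : ℕ) : ℚ) * (X - C a))) := by
    simp only [hq, derivative_mul, derivative_C, derivative_pow, derivative_sub, derivative_X,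
      Nat.add_sub_cancel]
    ring
  have haz : ∀ z : K, aeval z q = algebraMap ℚ K c *
      ((z - algebraMap ℚ K a) ^ (m + 1) * (algebraMap ℚ K b - z) ^ (n + 1)) := by
    intro z; simp [hq]
  refine ⟨q, ?_, hqa, by simp [hq], hqr, fun z hz => ?_⟩
  · intro h0
    rw [eq_C_of_natDegree_eq_zero h0] at hqa hqr
    simp only [eval_C] at hqa hqr
    exact zero_ne_one (hqa.symm.trans hqr)
  · have hcK : algebraMap ℚ K c ≠ 0 := (_root_.map_ne_zero _).mpr hc0
    rw [hder] at hz
    simp only [map_mul, aeval_C, map_sub, aeval_X, map_pow, mul_eq_zero, hcK, false_or] at hz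
    rcases hz with (hz | hz) | hz
    · left
      have := eq_zero_of_pow_eq_zero hz
      rw [haz, this]; simp
    · left
      have := eq_zero_of_pow_eq_zero hz
      rw [haz, this]; simp
    · right
      have hzr : z = algebraMap ℚ K r := by
        have hmn' := congrArg (algebraMap ℚ K) hmn
        simp only [map_mul, map_sub] at hmn'
        have hsum : algebraMap ℚ K (((m + 1 : ℕ) : ℚ) + ((n + 1 : ℕ) : ℚ)) ≠ 0 := by
          rw [Ne, map_eq_zero]; positivity
        refine mul_left_cancel₀ hsum ?_
        rw [map_add]
        linear_combination hmn' - hz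
      rw [hzr, aeval_algebraMap_apply, coe_aeval_eq_eval, hqr, map_one]

theorem exists_belyi_rational {K : Type*} [Field K] [Algebra ℚ K] (T : Finset ℚ) :
    ∃ P : ℚ[X], P.natDegree ≠ 0 ∧
      (∀ t ∈ algebraMap ℚ K '' T, aeval t P ∈ ({0, 1} : Set K)) ∧
      ∀ z : K, aeval z (derivative P) = 0 → aeval z P ∈ ({0, 1} : Set K) := by
  classical
  induction h : T.card using Nat.strong_induction_on generalizing T with
  | _ N ih =>
  by_cases h3 : ∃ a ∈ T, ∃ r ∈ T, ∃ b ∈ T, a < r ∧ r < b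
  · obtain ⟨a, ha, r, hr, b, hb, har, hrb⟩ := h3
    obtain ⟨q, hq, hqa, hqb, hqr, hqc⟩ := exists_belyi_step (K := K) har hrb
    have hsub : T.image (fun t => q.eval t) ⊆ (T.erase b).image (fun t => q.eval t) := by
      intro y hy
      obtain ⟨t, ht, rfl⟩ := Finset.mem_image.mp hy
      by_cases htb : t = b
      · refine Finset.mem_image.mpr ⟨a, Finset.mem_erase.mpr ⟨(har.trans hrb).ne, ha⟩, ?_⟩
        simp [htb, hqa, hqb]
      · exact Finset.mem_image.mpr ⟨t, Finset.mem_erase.mpr ⟨htb, ht⟩, rfl⟩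
    obtain ⟨g, hg, hgT, hgc⟩ := ih _ (((Finset.card_le_card hsub).trans
      Finset.card_image_le).trans_lt (h ▸ Finset.card_erase_lt_of_mem hb)) _ rfl
    refine exists_comp_critical hq hg ?_ ?_ hgT hgc
    · rintro _ ⟨t, ht, rfl⟩
      refine ⟨q.eval t, Finset.mem_coe.mpr (Finset.mem_image_of_mem _ ht), ?_⟩
      rw [aeval_algebraMap_apply, coe_aeval_eq_eval]
    · intro z hz
      rcases hqc z hz with h | h
      · exact ⟨0, Finset.mem_coe.mpr (Finset.mem_image.mpr ⟨a, ha, hqa⟩), by simp [h]⟩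
      · exact ⟨1, Finset.mem_coe.mpr (Finset.mem_image.mpr ⟨r, hr, hqr⟩), by simp [h]⟩
  · obtain ⟨a, b, hab, hT⟩ : ∃ a b : ℚ, a < b ∧ ∀ t ∈ T, t = a ∨ t = b := by
      rcases T.eq_empty_or_nonempty with rfl | hne
      · exact ⟨0, 1, one_pos, by simp⟩
      have hlo : ∀ t ∈ T, T.min' hne ≤ t := fun t ht => T.min'_le t ht
      have hhi : ∀ t ∈ T, t ≤ T.max' hne := fun t ht => T.le_max' t ht
      rcases (hlo _ (T.max'_mem hne)).lt_or_eq with hlt | heq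
      · refine ⟨_, _, hlt, fun t ht => ?_⟩
        by_contra! hcon
        exact h3 ⟨_, T.min'_mem hne, t, ht, _, T.max'_mem hne,
          (hlo t ht).lt_of_ne hcon.1.symm, (hhi t ht).lt_of_ne hcon.2⟩
      · exact ⟨T.min' hne, T.min' hne + 1, lt_add_one _, fun t ht =>
          Or.inl (le_antisymm (heq ▸ hhi t ht) (hlo t ht))⟩
    have hba : b - a ≠ 0 := (sub_pos.mpr hab).ne'
    have hinv : (b - a)⁻¹ ≠ 0 := inv_ne_zero hba
    refine ⟨C (b - a)⁻¹ * (X - C a), ?_, ?_, ?_⟩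
    · rw [natDegree_C_mul hinv, natDegree_X_sub_C]; exact one_ne_zero
    · rintro _ ⟨t, ht, rfl⟩
      rw [aeval_algebraMap_apply, coe_aeval_eq_eval]
      rcases hT t ht with rfl | rfl
      · left; simp
      · right; simp [inv_mul_cancel₀ hba]
    · intro z hz
      rw [derivative_C_mul, derivative_X_sub_C, mul_one, aeval_C, map_eq_zero] at hz
      exact absurd hz hinv

/-- Belyi's theorem for the projective line over `ℚ`, in the form given by a polynomial map. -/
theorem exists_belyi {K : Type*} [Field K] [Algebra ℚ K] [Algebra.IsAlgebraic ℚ K]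
    (S : Finset K) :
    ∃ P : ℚ[X], P.natDegree ≠ 0 ∧ (∀ s ∈ (S : Set K), aeval s P ∈ ({0, 1} : Set K)) ∧
      ∀ z : K, aeval z (derivative P) = 0 → aeval z P ∈ ({0, 1} : Set K) := by
  classical
  obtain ⟨g, hg, hgS, hgc⟩ := exists_rational_critical_values
    (S.sup fun s => (minpoly ℚ s).natDegree) S
    fun s hs => (Finset.le_sup (f := fun s => (minpoly ℚ s).natDegree) hs).trans (Nat.le_succ _)
  have hg' : derivative g ≠ 0 := fun h => hg (derivative_eq_zero.mp h)
  set V : Finset K := S.image (fun z => aeval z g) ∪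
    ((derivative g).aroots K).toFinset.image (fun z => aeval z g) with hV
  have hcrit : ∀ z : K, aeval z (derivative g) = 0 → aeval z g ∈ V := fun z hz =>
    Finset.mem_union_right _ (Finset.mem_image_of_mem _ (by simpa [hg'] using hz))
  have hVr : ∀ v ∈ V, v ∈ Set.range (algebraMap ℚ K) := by
    intro v hv
    rcases Finset.mem_union.mp hv with hv | hv
    · obtain ⟨z, hz, rfl⟩ := Finset.mem_image.mp hv
      exact hgS z hz
    · obtain ⟨z, hz, rfl⟩ := Finset.mem_image.mp hv
      exact hgc z (by simpa [hg'] using hz)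
  set T : Finset ℚ := V.preimage (algebraMap ℚ K) (algebraMap ℚ K).injective.injOn
  have hVT : ∀ v ∈ V, v ∈ algebraMap ℚ K '' T := by
    intro v hv
    obtain ⟨t, rfl⟩ := hVr v hv
    exact ⟨t, by simpa [T] using hv, rfl⟩
  obtain ⟨P, hP, hPT, hPc⟩ := exists_belyi_rational (K := K) T
  exact exists_comp_critical hg hP
    (fun s hs => hVT _ (Finset.mem_union_left _ (Finset.mem_image_of_mem _ hs)))
    (fun z hz => hVT _ (hcrit z hz)) hPT hPc

theorem dvd_of_rootMultiplicity_le {F K : Type*} [Field F] [Field K] [IsAlgClosed K] [Algebra F K]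
    {p q : F[X]} (hp : p ≠ 0)
    (h : ∀ z : K, (p.map (algebraMap F K)).rootMultiplicity z ≤
      (q.map (algebraMap F K)).rootMultiplicity z) : p ∣ q := by
  classical
  rw [← Polynomial.map_dvd_map' (algebraMap F K)]
  refine (IsAlgClosed.splits _).dvd_of_roots_le_roots
    ((Polynomial.map_ne_zero_iff (algebraMap F K).injective).mpr hp) ?_
  rw [Multiset.le_iff_count]
  intro z
  rw [count_roots, count_roots]
  exact h z

open scoped Classical in
theorem rootMultiplicity_mul_sub_one {K : Type*} [Field K] [CharZero K] {p : K[X]}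
    (hp : p.natDegree ≠ 0) (hc : ∀ z, (derivative p).eval z = 0 → p.eval z = 0 ∨ p.eval z = 1)
    (z : K) : (p * (p - 1)).rootMultiplicity z =
      (derivative p).rootMultiplicity z + if p.eval z = 0 ∨ p.eval z = 1 then 1 else 0 := by
  have hp0 : p ≠ 0 := by rintro rfl; simp at hp
  have hp1 : p - 1 ≠ 0 := by
    intro h; rw [sub_eq_zero] at h; rw [h] at hp; simp at hp
  have hd : derivative (p - 1) = derivative p := by simp
  rw [rootMultiplicity_mul (mul_ne_zero hp0 hp1)]
  by_cases h0 : p.eval z = 0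
  · have h1 : (p - 1).rootMultiplicity z = 0 :=
      rootMultiplicity_eq_zero (by simp [h0])
    rw [derivative_rootMultiplicity_of_root (p := p) h0, h1, if_pos (Or.inl h0)]
    have := (rootMultiplicity_pos hp0).mpr h0
    omega
  · have h0' : p.rootMultiplicity z = 0 := rootMultiplicity_eq_zero h0
    by_cases h1 : p.eval z = 1
    · have hr : (p - 1).IsRoot z := by simp [h1]
      rw [← hd, derivative_rootMultiplicity_of_root hr, h0', if_pos (Or.inr h1)]
      have := (rootMultiplicity_pos hp1).mpr hr
      omega
    · have h1' : (p - 1).rootMultiplicity z = 0 :=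
        rootMultiplicity_eq_zero (by simpa [sub_eq_zero] using h1)
      have h2 : (derivative p).rootMultiplicity z = 0 :=
        rootMultiplicity_eq_zero fun h => (hc z h).elim h0 h1
      rw [h0', h1', h2, if_neg (by tauto)]

theorem exists_belyi_identity_of_isAlgClosure (K : Type*) [Field K] [Algebra ℚ K]
    [IsAlgClosed K] [Algebra.IsAlgebraic ℚ K] {f : ℚ[X]} (hsf : Squarefree f) :
    ∃ P R : ℚ[X], P.natDegree ≠ 0 ∧ (f * R).natDegree = P.natDegree + 1 ∧
      ∃ m : ℕ, P * (P - 1) ∣ (f * R) ^ m := by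
  classical
  have : CharZero K := algebraRat.charZero K
  have hf0 : f ≠ 0 := hsf.ne_zero
  obtain ⟨P, hP, hPf, hPc⟩ := exists_belyi (K := K) (f.aroots K).toFinset
  set φ := algebraMap ℚ K
  have hev : ∀ (z : K) (p : ℚ[X]), (p.map φ).eval z = aeval z p := fun z p => eval_map_algebraMap p z
  have hPd : (P.map φ).natDegree ≠ 0 := by rwa [natDegree_map]
  have hcrit : ∀ z, (derivative (P.map φ)).eval z = 0 →
      (P.map φ).eval z = 0 ∨ (P.map φ).eval z = 1 := by
    intro z hz
    rw [derivative_map, hev] at hz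
    rw [hev]
    exact hPc z hz
  have key := rootMultiplicity_mul_sub_one hPd hcrit
  have hQmap : (P * (P - 1)).map φ = P.map φ * (P.map φ - 1) := by simp
  rw [← hQmap, derivative_map] at key
  have hd0 : derivative P ≠ 0 := fun h => hP (derivative_eq_zero.mp h)
  have hP0 : P ≠ 0 := by rintro rfl; simp at hP
  have hP1 : P - 1 ≠ 0 := by
    intro h; rw [sub_eq_zero] at h; rw [h] at hP; simp at hP
  have hQ0 : P * (P - 1) ≠ 0 := mul_ne_zero hP0 hP1
  obtain ⟨W, hW⟩ : derivative P ∣ P * (P - 1) :=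
    dvd_of_rootMultiplicity_le (K := K) hd0 fun z => (Nat.le_add_right _ _).trans (key z).ge
  have hinj := φ.injective
  have hW0 : W ≠ 0 := by rintro rfl; simp [hQ0] at hW
  have hWm : ∀ z : K, (W.map φ).rootMultiplicity z =
      if (P.map φ).eval z = 0 ∨ (P.map φ).eval z = 1 then 1 else 0 := by
    intro z
    have h1 := key z
    rw [hW, Polynomial.map_mul, rootMultiplicity_mul] at h1
    · omega
    · rw [← Polynomial.map_mul, Polynomial.map_ne_zero_iff hinj]
      exact mul_ne_zero hd0 hW0
  obtain ⟨R, hR⟩ : f ∣ W := by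
    refine dvd_of_rootMultiplicity_le (K := K) hf0 fun z => ?_
    have hsep : f.Separable := PerfectField.separable_iff_squarefree.mpr hsf
    have h1 : (f.map φ).rootMultiplicity z ≤ 1 :=
      rootMultiplicity_le_one_of_separable hsep.map z
    by_cases hz : aeval z f = 0
    · have := hPf z (by simpa [hf0] using hz)
      rw [hWm z, hev, if_pos (by simpa using this)]
      exact h1
    · rw [rootMultiplicity_eq_zero (by rw [IsRoot.def, hev]; exact hz)]
      exact Nat.zero_le _
  refine ⟨P, R, hP, ?_, (P * (P - 1)).natDegree, ?_⟩
  · rw [← hR]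
    have h1 := congrArg natDegree hW
    rw [natDegree_mul hP0 hP1, natDegree_mul hd0 hW0, natDegree_derivative] at h1
    have h2 : (P - 1).natDegree = P.natDegree := by
      rw [← C_1, natDegree_sub_C]
    omega
  · rw [← hR]
    refine dvd_of_rootMultiplicity_le (K := K) hQ0 fun z => ?_
    rw [Polynomial.map_pow, ← count_roots ((W.map φ) ^ _), roots_pow, Multiset.count_nsmul,
      count_roots, hWm z]
    split_ifs with hz
    · rw [mul_one, ← natDegree_map φ, ← count_roots]
      exact (Multiset.count_le_card _ _).trans (card_roots' _)
    · have h0 : ((P * (P - 1)).map φ).rootMultiplicity z = 0 := by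
        refine rootMultiplicity_eq_zero ?_
        rw [hQmap]
        simp only [IsRoot.def, eval_mul, eval_sub, eval_one, mul_eq_zero, sub_eq_zero]
        exact hz
      rw [h0]
      exact Nat.zero_le _

theorem exists_belyi_identity {f : ℚ[X]} (hsf : Squarefree f) :
    ∃ P R : ℚ[X], P.natDegree ≠ 0 ∧ (f * R).natDegree = P.natDegree + 1 ∧
      ∃ m : ℕ, P * (P - 1) ∣ (f * R) ^ m :=
  letI : Algebra ℚ (AlgebraicClosure ℚ) := AlgebraicClosure.instAlgebra ℚ
  have : Algebra.IsAlgebraic ℚ (AlgebraicClosure ℚ) := AlgebraicClosure.isAlgebraic ℚ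
  exists_belyi_identity_of_isAlgClosure (AlgebraicClosure ℚ) hsf

theorem exists_integer_multiple (P : ℚ[X]) :
    ∃ (c : ℤ) (p : ℤ[X]), c ≠ 0 ∧ p.map (Int.castRingHom ℚ) = C (c : ℚ) * P := by
  obtain ⟨c, hc, hb⟩ := IsLocalization.integerNormalization_spec (nonZeroDivisors ℤ) P
  refine ⟨c, _, nonZeroDivisors.ne_zero hc, hb.trans ?_⟩
  ext j
  simp

theorem exists_belyi_identity_int {f : ℤ[X]}
    (hsf : Squarefree (f.map (Int.castRingHom ℚ))) :
    ∃ (p r u : ℤ[X]) (M κ : ℤ) (m : ℕ), p.natDegree ≠ 0 ∧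
      (f * r).natDegree = p.natDegree + 1 ∧ M ≠ 0 ∧ κ ≠ 0 ∧
      p * (p - C M) * u = C κ * (f * r) ^ m := by
  obtain ⟨P, R, hP, hdeg, m, U, hU⟩ := exists_belyi_identity hsf
  obtain ⟨c₁, p, hc₁, hp⟩ := exists_integer_multiple P
  obtain ⟨c₂, r, hc₂, hr⟩ := exists_integer_multiple R
  obtain ⟨c₃, u, hc₃, hu⟩ := exists_integer_multiple U
  have hinj : Function.Injective (Int.castRingHom ℚ) := Int.cast_injective
  have hpd : p.natDegree = P.natDegree := by
    rw [← natDegree_map_eq_of_injective hinj, hp,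
      natDegree_C_mul (Int.cast_ne_zero.mpr hc₁)]
  refine ⟨p, r, C (c₂ ^ m) * u, c₁, c₁ ^ 2 * c₃, m, hpd ▸ hP, ?_, hc₁,
    mul_ne_zero (pow_ne_zero _ hc₁) hc₃, ?_⟩
  · rw [hpd, ← hdeg, ← natDegree_map_eq_of_injective hinj, Polynomial.map_mul, hr,
      mul_left_comm, natDegree_C_mul (Int.cast_ne_zero.mpr hc₂)]
  · apply map_injective _ hinj
    simp only [Polynomial.map_mul, Polynomial.map_sub, Polynomial.map_pow, map_C, hp, hr, hu,
      Int.coe_castRingHom, C_mul, C_pow, mul_pow] at hU ⊢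
    linear_combination (-C (c₁ : ℚ) ^ 2 * C (c₃ : ℚ) * C (c₂ : ℚ) ^ m) * hU

/-- The value at `(a, b)` of the degree `N` homogenization of `f`. -/
def homEval (f : ℤ[X]) (N : ℕ) (a b : ℤ) : ℤ :=
  ∑ j ∈ Finset.range (N + 1), f.coeff j * a ^ j * b ^ (N - j)

theorem homEval_succ (f : ℤ[X]) (N : ℕ) (a b : ℤ) :
    homEval f (N + 1) a b = f.coeff (N + 1) * a ^ (N + 1) + b * homEval f N a b := by
  rw [homEval, Finset.sum_range_succ, Nat.sub_self, pow_zero, mul_one, add_comm, homEval,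
    Finset.mul_sum]
  congr 1
  refine Finset.sum_congr rfl fun j hj => ?_
  rw [Nat.succ_sub (Nat.lt_succ_iff.mp (Finset.mem_range.mp hj)), pow_succ]
  ring

theorem cast_homEval {f : ℤ[X]} {N : ℕ} (hN : f.natDegree ≤ N) {a b : ℤ} (hb : b ≠ 0) :
    (homEval f N a b : ℚ) = (b : ℚ) ^ N * aeval ((a : ℚ) / b) f := by
  have hb' : (b : ℚ) ≠ 0 := Int.cast_ne_zero.mpr hb
  rw [aeval_eq_sum_range' (Nat.lt_succ_iff.mpr hN), homEval, Finset.mul_sum, Int.cast_sum]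
  refine Finset.sum_congr rfl fun j hj => ?_
  have hj' : j ≤ N := Nat.lt_succ_iff.mp (Finset.mem_range.mp hj)
  have h : (b : ℚ) ^ N = (b : ℚ) ^ (N - j) * (b : ℚ) ^ j := by rw [← pow_add]; congr; omega
  rw [h, div_pow, zsmul_eq_mul]
  push_cast
  field_simp

theorem abs_homEval_le (f : ℤ[X]) (N : ℕ) : ∃ S : ℝ, 1 ≤ S ∧ ∀ a b : ℤ,
    |(homEval f N a b : ℝ)| ≤ S * (max |(a : ℝ)| |(b : ℝ)|) ^ N := by
  refine ⟨1 + ∑ j ∈ Finset.range (N + 1), |(f.coeff j : ℝ)|,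
    le_add_of_nonneg_right (by positivity), fun a b => ?_⟩
  set H := max |(a : ℝ)| |(b : ℝ)|
  have hH : 0 ≤ H := (abs_nonneg _).trans (le_max_left _ _)
  have h1 : |(homEval f N a b : ℝ)| ≤ ∑ j ∈ Finset.range (N + 1), |(f.coeff j : ℝ)| * H ^ N := by
    rw [homEval, Int.cast_sum]
    refine (Finset.abs_sum_le_sum_abs _ _).trans (Finset.sum_le_sum fun j hj => ?_)
    have hj' : j ≤ N := Nat.lt_succ_iff.mp (Finset.mem_range.mp hj)
    have h : H ^ N = H ^ j * H ^ (N - j) := by rw [← pow_add]; congr; omega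
    push_cast
    rw [abs_mul, abs_mul, abs_pow, abs_pow, h, ← mul_assoc]
    gcongr
    · exact le_max_left _ _
    · exact le_max_right _ _
  rw [← Finset.sum_mul] at h1
  refine h1.trans ?_
  gcongr
  linarith

theorem pow_max_le_homEval {p : ℤ[X]} {D : ℕ} (hp : p.coeff (D + 1) ≠ 0) :
    ∃ c : ℝ, 0 < c ∧ ∀ a b : ℤ, (max |(a : ℝ)| |(b : ℝ)|) ^ (D + 1) ≤
      c * max |(homEval p (D + 1) a b : ℝ)| (|(b : ℝ)| ^ (D + 1)) := by
  obtain ⟨S, hS1, hS⟩ := abs_homEval_le p D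
  refine ⟨2 + (2 * S) ^ (D + 1), by positivity, fun a b => ?_⟩
  have hZ := hS a b
  set Z := homEval p D a b
  have hA : (homEval p (D + 1) a b : ℝ) = p.coeff (D + 1) * (a : ℝ) ^ (D + 1) + b * Z := by
    rw [homEval_succ]; push_cast; rfl
  set A : ℝ := (homEval p (D + 1) a b : ℝ)
  set m := max |A| (|(b : ℝ)| ^ (D + 1)) with hm
  have hAm : |A| ≤ m := le_max_left _ _
  have hbm : |(b : ℝ)| ^ (D + 1) ≤ m := le_max_right _ _
  have hm0 : 0 ≤ m := (abs_nonneg _).trans hAm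
  have hSp : 0 ≤ (2 * S) ^ (D + 1) := by positivity
  rcases le_total |(a : ℝ)| |(b : ℝ)| with hab | hab
  · rw [max_eq_right hab]
    nlinarith
  · rw [max_eq_left hab] at hZ ⊢
    rcases le_total |(a : ℝ)| (2 * S * |(b : ℝ)|) with h | h
    · calc |(a : ℝ)| ^ (D + 1) ≤ (2 * S * |(b : ℝ)|) ^ (D + 1) := by gcongr
        _ = (2 * S) ^ (D + 1) * |(b : ℝ)| ^ (D + 1) := mul_pow _ _ _
        _ ≤ (2 * S) ^ (D + 1) * m := by gcongr
        _ ≤ _ := by nlinarith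
    · have hl : (1 : ℝ) ≤ |(p.coeff (D + 1) : ℝ)| := by
        exact_mod_cast Int.one_le_abs hp
      have h1 : |(a : ℝ)| ^ (D + 1) ≤ |(p.coeff (D + 1) : ℝ) * (a : ℝ) ^ (D + 1)| := by
        rw [abs_mul, abs_pow]
        exact le_mul_of_one_le_left (by positivity) hl
      have h2 : |(p.coeff (D + 1) : ℝ) * (a : ℝ) ^ (D + 1)| ≤ |A| + |(b : ℝ) * Z| := by
        rw [show (p.coeff (D + 1) : ℝ) * (a : ℝ) ^ (D + 1) = A - b * Z by rw [hA]; ring]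
        exact abs_sub _ _
      have h3 : |(b : ℝ) * Z| ≤ |(a : ℝ)| ^ (D + 1) / 2 := by
        rw [abs_mul]
        calc |(b : ℝ)| * |(Z : ℝ)| ≤ |(b : ℝ)| * (S * |(a : ℝ)| ^ D) := by gcongr
          _ = (2 * S * |(b : ℝ)|) * |(a : ℝ)| ^ D / 2 := by ring
          _ ≤ |(a : ℝ)| * |(a : ℝ)| ^ D / 2 := by gcongr
          _ = _ := by ring
      nlinarith

theorem dvd_of_dvd_homEval {p : ℤ[X]} {D : ℕ} {a b M g : ℤ} (hab : IsCoprime a b)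
    (hA : g ∣ homEval p (D + 1) a b) (hC : g ∣ M * b ^ (D + 1)) :
    g ∣ M * p.coeff (D + 1) ^ (D + 1) := by
  set l := p.coeff (D + 1)
  set E := D + 1
  have h1 : g ∣ M * l ^ E * (a ^ E) ^ E := by
    rw [homEval_succ] at hA
    rw [← sub_neg_eq_add] at hA
    have h2 := hA.trans (sub_dvd_pow_sub_pow _ _ E)
    have h3 : g ∣ M * (-(b * homEval p D a b)) ^ E := by
      rw [neg_pow, mul_pow]
      exact (hC.mul_right ((-1) ^ E * homEval p D a b ^ E)).trans (dvd_of_eq (by ring))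
    have h4 := (h2.mul_left M).add h3
    exact h4.trans (dvd_of_eq (by ring))
  have h5 : g ∣ M * l ^ E * b ^ E := (hC.mul_right (l ^ E)).trans (dvd_of_eq (by ring))
  obtain ⟨s, t, hst⟩ : IsCoprime ((a ^ E) ^ E) (b ^ E) := (hab.pow_left.pow_left).pow_right
  have h6 := (h1.mul_right s).add (h5.mul_right t)
  refine h6.trans (dvd_of_eq ?_)
  linear_combination (M * l ^ E) * hst

theorem one_le_intRadical (m : ℤ) : 1 ≤ IntRadical m :=
  Nat.one_le_iff_ne_zero.mpr (Finset.prod_ne_zero_iff.mpr fun _ hp =>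
    (Nat.prime_of_mem_primeFactors hp).ne_zero)

theorem intRadical_le_of_forall_prime {m m' : ℤ} (hm' : m' ≠ 0)
    (h : ∀ ℓ : ℕ, ℓ.Prime → (ℓ : ℤ) ∣ m → (ℓ : ℤ) ∣ m') : IntRadical m ≤ IntRadical m' := by
  refine Finset.prod_le_prod_of_subset_of_one_le' (fun ℓ hℓ => ?_) fun ℓ hℓ _ =>
    (Nat.prime_of_mem_primeFactors hℓ).one_le
  have hℓp := Nat.prime_of_mem_primeFactors hℓ
  exact Nat.mem_primeFactors.mpr ⟨hℓp, Int.natCast_dvd.mp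
    (h ℓ hℓp (Int.natCast_dvd.mpr (Nat.dvd_of_mem_primeFactors hℓ))), Int.natAbs_ne_zero.mpr hm'⟩

theorem intRadical_mul_le {x y : ℤ} (hx : x ≠ 0) (hy : y ≠ 0) :
    IntRadical (x * y) ≤ x.natAbs * IntRadical y := by
  rw [IntRadical, Int.natAbs_mul, Nat.primeFactors_mul (by simpa) (by simpa)]
  calc _ ≤ (∏ p ∈ x.natAbs.primeFactors, p) * ∏ p ∈ y.natAbs.primeFactors, p := by
        rw [← Finset.prod_union_inter]
        exact Nat.le_mul_of_pos_right _ (Finset.prod_pos fun p hp =>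
          (Nat.prime_of_mem_primeFactors (Finset.mem_inter.mp hp).1).pos)
    _ ≤ _ := Nat.mul_le_mul_right _ (Nat.le_of_dvd (Int.natAbs_pos.mpr hx)
        (Nat.prod_primeFactors_dvd _))

theorem exists_bound_of_homEval_eq_zero {r : ℤ[X]} (hr : r ≠ 0) :
    ∃ B : ℝ, 1 ≤ B ∧ ∀ a b : ℤ, IsCoprime a b → b ≠ 0 → homEval r r.natDegree a b = 0 →
      max |(a : ℝ)| |(b : ℝ)| ≤ B := by
  classical
  refine ⟨1 + ∑ x ∈ (r.aroots ℚ).toFinset, (|(x.num : ℝ)| + x.den),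
    le_add_of_nonneg_right (by positivity), fun a b hab hb h => ?_⟩
  set x : ℚ := (a : ℚ) / b with hx
  have hb' : (b : ℚ) ≠ 0 := Int.cast_ne_zero.mpr hb
  have hroot : aeval x r = 0 := by
    have h1 := cast_homEval (le_refl r.natDegree) (a := a) hb
    rw [h, Int.cast_zero, eq_comm, mul_eq_zero] at h1
    exact h1.resolve_left (pow_ne_zero _ hb')
  have hmem : x ∈ (r.aroots ℚ).toFinset := by
    rw [Multiset.mem_toFinset, mem_aroots]; exact ⟨hr, hroot⟩
  have hle := Finset.single_le_sum (f := fun x : ℚ => |(x.num : ℝ)| + x.den)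
    (fun _ _ => by positivity) hmem
  have hcross : a * x.den = x.num * b := by
    have h1 := Rat.mul_den_eq_num x
    have h2 : (a : ℚ) = x * b := by rw [hx]; field_simp
    have h3 : (a : ℚ) * x.den = x.num * b := by rw [h2, ← h1]; ring
    exact_mod_cast h3
  have hden : (x.den : ℤ) ≠ 0 := by exact_mod_cast x.den_ne_zero
  have ha : |a| ≤ |x.num| := by
    by_cases ha : x.num = 0
    · have : a = 0 := by
        rw [ha, zero_mul] at hcross
        exact (mul_eq_zero.mp hcross).resolve_right hden
      simp [this]
    · exact Int.le_of_dvd (abs_pos.mpr ha)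
        ((abs_dvd_abs _ _).mpr (hab.dvd_of_dvd_mul_right ⟨_, hcross.symm⟩))
  have hbd : |b| ≤ x.den := by
    have h1 : b ∣ (x.den : ℤ) := hab.symm.dvd_of_dvd_mul_left ⟨x.num, by rw [hcross, mul_comm]⟩
    exact Int.le_of_dvd (by positivity) ((abs_dvd _ _).mpr h1)
  have ha' : |(a : ℝ)| ≤ |(x.num : ℝ)| := by exact_mod_cast ha
  have hb'' : |(b : ℝ)| ≤ x.den := by exact_mod_cast hbd
  have h1 : (0 : ℝ) ≤ x.den := by positivity
  have h2 := abs_nonneg (x.num : ℝ)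
  refine max_le ?_ ?_ <;> linarith

theorem rpow_le_of_pow_le {δ K q : ℝ} {D : ℕ} (hδ : 0 < δ) (hD : 1 ≤ D) (hK : 0 < K) :
    ∃ c : ℝ, 0 < c ∧ ∀ H R : ℝ, 1 ≤ H → 0 < R →
      H ^ D ≤ K * (R * H ^ q) ^ (1 + δ / D) → c * H ^ ((D : ℝ) - q - δ) ≤ R := by
  have hD0 : (0 : ℝ) < D := by exact_mod_cast hD
  set ε := δ / D with hε
  have hε0 : 0 < ε := div_pos hδ hD0
  have h1ε : 0 < 1 + ε := by linarith
  refine ⟨K ^ (-(1 + ε)⁻¹), by positivity, fun H R hH hR h => ?_⟩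
  have hH0 : 0 < H := by linarith
  have h1 := Real.rpow_le_rpow (by positivity) h (inv_nonneg.mpr h1ε.le)
  rw [Real.mul_rpow hK.le (by positivity), ← Real.rpow_mul (by positivity),
    mul_inv_cancel₀ h1ε.ne', Real.rpow_one, ← Real.rpow_natCast, ← Real.rpow_mul hH0.le] at h1
  have h2 : (D : ℝ) - δ ≤ D * (1 + ε)⁻¹ := by
    rw [← div_eq_mul_inv, le_div_iff₀ h1ε]
    have : D * ε = δ := by rw [hε]; field_simp
    nlinarith
  have h3 : H ^ ((D : ℝ) - δ) ≤ K ^ (1 + ε)⁻¹ * (R * H ^ q) :=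
    (Real.rpow_le_rpow_of_exponent_le hH h2).trans h1
  rw [Real.rpow_neg hK.le, inv_mul_le_iff₀ (by positivity),
    show (D : ℝ) - q - δ = (D - δ) - q by ring, Real.rpow_sub hH0, div_le_iff₀ (by positivity)]
  linarith

theorem abc_coprime_quotient {K ε : ℝ} (hε : 0 < ε) (hK : 0 < K)
    (habc : ∀ a b c : ℤ, a ≠ 0 → b ≠ 0 → c ≠ 0 →
      IsCoprime a b → IsCoprime a c → IsCoprime b c → a + b = c →
      ((max (max |a| |b|) |c| : ℤ) : ℝ) ≤ K * (IntRadical (a * b * c) : ℝ) ^ (1 + ε))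
    {A C G m : ℤ} (hA : A ≠ 0) (hC : C ≠ 0) (hAC : A ≠ C) (hG : G ≠ 0) (hm : m ≠ 0)
    (hgcd : ∀ g, g ∣ A → g ∣ C → g ∣ G)
    (hprime : ∀ ℓ : ℕ, ℓ.Prime → (ℓ : ℤ) ∣ A * (A - C) * C → (ℓ : ℤ) ∣ m) :
    max |(A : ℝ)| |(C : ℝ)| ≤ |(G : ℝ)| * (K * (IntRadical m : ℝ) ^ (1 + ε)) := by
  obtain ⟨g, A₁, C₁, hg0, hcop, rfl, rfl⟩ :
      ∃ g A₁ C₁ : ℤ, g ≠ 0 ∧ IsCoprime A₁ C₁ ∧ A = g * A₁ ∧ C = g * C₁ := by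
    have hpos : 0 < Int.gcd A C := Int.gcd_pos_of_ne_zero_left _ hA
    obtain ⟨A₁, C₁, hcop, h1, h2⟩ := Int.exists_gcd_one hpos
    exact ⟨Int.gcd A C, A₁, C₁, by exact_mod_cast hpos.ne', Int.isCoprime_iff_gcd_eq_one.mpr hcop,
      h1.trans (mul_comm _ _), h2.trans (mul_comm _ _)⟩
  have hA₁ := right_ne_zero_of_mul hA
  have hC₁ := right_ne_zero_of_mul hC
  have hB₁ : C₁ - A₁ ≠ 0 := fun h => hAC (by rw [sub_eq_zero.mp h])
  have hab : IsCoprime A₁ (C₁ - A₁) := by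
    obtain ⟨s, t, h⟩ := hcop
    exact ⟨s + t, t, by linear_combination h⟩
  have hbc : IsCoprime (C₁ - A₁) C₁ := by
    obtain ⟨s, t, h⟩ := hcop
    exact ⟨-s, s + t, by linear_combination h⟩
  have h1 := habc A₁ (C₁ - A₁) C₁ hA₁ hB₁ hC₁ hab hcop hbc (by ring)
  have hrad : IntRadical (A₁ * (C₁ - A₁) * C₁) ≤ IntRadical m := by
    refine intRadical_le_of_forall_prime hm fun ℓ hℓ hd => hprime ℓ hℓ ?_
    exact hd.trans ⟨-g ^ 3, by ring⟩
  have h2 : K * (IntRadical (A₁ * (C₁ - A₁) * C₁) : ℝ) ^ (1 + ε) ≤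
      K * (IntRadical m : ℝ) ^ (1 + ε) := by gcongr
  have hgG : |(g : ℝ)| ≤ |(G : ℝ)| := by
    have := Int.le_of_dvd (abs_pos.mpr hG) ((abs_dvd_abs _ _).mpr
      (hgcd g (dvd_mul_right _ _) (dvd_mul_right _ _)))
    exact_mod_cast this
  have h3 := h1.trans h2
  push_cast at h3 ⊢
  rw [abs_mul, abs_mul, ← mul_max_of_nonneg _ _ (abs_nonneg _)]
  refine mul_le_mul hgG ((max_le_max_right _ (le_max_left _ _)).trans h3) (by positivity)
    (abs_nonneg _)

/-- The abc conjecture implies a lower bound for the radical of the values of a squarefree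
polynomial. -/
theorem ABCConjecture.le_intRadical_homEval (habc : ABCConjecture) {f : ℤ[X]}
    (hsf : Squarefree (f.map (Int.castRingHom ℚ))) {δ : ℝ} (hδ : 0 < δ) :
    ∃ c : ℝ, 0 < c ∧ ∀ a b : ℤ, IsCoprime a b → b ≠ 0 → homEval f f.natDegree a b ≠ 0 →
      c * (max |(a : ℝ)| |(b : ℝ)|) ^ ((f.natDegree : ℝ) - 1 - δ) ≤
        IntRadical (b * homEval f f.natDegree a b) := by
  obtain ⟨p, r, u, M, κ, n, hp, hdeg, hM, hκ, hid⟩ := exists_belyi_identity_int hsf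
  obtain ⟨D, hD⟩ := Nat.exists_eq_succ_of_ne_zero hp
  rw [Nat.succ_eq_add_one] at hD
  have hfr : f * r ≠ 0 := by intro h; rw [h] at hdeg; simp at hdeg
  have hf0 : f ≠ 0 := left_ne_zero_of_mul hfr
  have hr0 : r ≠ 0 := right_ne_zero_of_mul hfr
  rw [natDegree_mul hf0 hr0, hD] at hdeg
  have hl : p.coeff (D + 1) ≠ 0 := by
    rw [← hD, coeff_natDegree, Ne, leadingCoeff_eq_zero]
    rintro rfl
    simp at hp
  set N := f.natDegree with hN
  set G : ℤ := M * p.coeff (D + 1) ^ (D + 1) with hG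
  have hG0 : G ≠ 0 := mul_ne_zero hM (pow_ne_zero _ hl)
  have hG0' : (0 : ℝ) < |(G : ℝ)| := abs_pos.mpr (Int.cast_ne_zero.mpr hG0)
  obtain ⟨B, hB1, hB⟩ := exists_bound_of_homEval_eq_zero hr0
  obtain ⟨c₀, hc₀, hgrow⟩ := pow_max_le_homEval hl
  obtain ⟨S, hS1, hS⟩ := abs_homEval_le r r.natDegree
  have hε : 0 < δ / (D + 1 : ℕ) := div_pos hδ (by positivity)
  obtain ⟨K, hK, habcK⟩ := habc _ hε
  set ε := δ / (D + 1 : ℕ) with hεdef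
  set T : ℝ := |((M * κ : ℤ) : ℝ)| * S with hT
  have hTpos : 0 < T := mul_pos (abs_pos.mpr (Int.cast_ne_zero.mpr (mul_ne_zero hM hκ)))
    (by linarith)
  have hK' : 0 < c₀ * (|(G : ℝ)| * (K * T ^ (1 + ε))) := by positivity
  obtain ⟨c₁, hc₁, hfin⟩ := rpow_le_of_pow_le (q := r.natDegree) hδ (Nat.succ_pos D) hK'
  have hBN : 0 < B ^ (-(N : ℝ)) := by positivity
  refine ⟨min c₁ (B ^ (-(N : ℝ))), lt_min hc₁ hBN, fun a b hab hb hF => ?_⟩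
  set H := max |(a : ℝ)| |(b : ℝ)| with hH
  have hH1 : 1 ≤ H := le_max_of_le_right (by exact_mod_cast Int.one_le_abs hb)
  set F := homEval f N a b
  have hR1 : (1 : ℝ) ≤ IntRadical (b * F) := by exact_mod_cast one_le_intRadical _
  by_cases hrh : homEval r r.natDegree a b = 0
  · have hHB : H ≤ B := hB a b hab hb hrh
    calc min c₁ (B ^ (-(N : ℝ))) * H ^ ((N : ℝ) - 1 - δ)
        ≤ B ^ (-(N : ℝ)) * H ^ (N : ℝ) := by
          gcongr
          · exact min_le_right _ _
          · linarith
      _ ≤ B ^ (-(N : ℝ)) * B ^ (N : ℝ) := by gcongr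
      _ = 1 := by rw [← Real.rpow_add (by linarith), neg_add_cancel, Real.rpow_zero]
      _ ≤ _ := hR1
  set ρ := homEval r r.natDegree a b with hρ
  set A := homEval p (D + 1) a b with hA
  set U := homEval u u.natDegree a b with hU
  have hbQ : (b : ℚ) ≠ 0 := Int.cast_ne_zero.mpr hb
  have hident : A * (A - M * b ^ (D + 1)) * U * b ^ (n * (D + 2)) =
      κ * (F * ρ) ^ n * b ^ (2 * (D + 1) + u.natDegree) := by
    have h1 := cast_homEval (f := p) (N := D + 1) hD.le (a := a) hb
    have h2 := cast_homEval (f := u) le_rfl (a := a) hb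
    have h3 := cast_homEval (f := f) le_rfl (a := a) hb
    have h4 := cast_homEval (f := r) le_rfl (a := a) hb
    have h5 := congrArg (aeval ((a : ℚ) / b)) hid
    simp only [map_mul, map_sub, map_pow, eq_intCast, map_intCast] at h5
    have hpow : (b : ℚ) ^ (n * (D + 2)) = ((b : ℚ) ^ N * (b : ℚ) ^ r.natDegree) ^ n := by
      rw [← pow_add, ← pow_mul, hdeg, mul_comm n]
    rw [← Int.cast_inj (α := ℚ)]
    push_cast
    rw [h1, h2, h3, h4, hpow]
    linear_combination ((b : ℚ) ^ (D + 1)) ^ 2 * (b : ℚ) ^ u.natDegree *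
      ((b : ℚ) ^ N * (b : ℚ) ^ r.natDegree) ^ n * h5
  have hne : A * (A - M * b ^ (D + 1)) * U * b ^ (n * (D + 2)) ≠ 0 := by
    rw [hident]
    exact mul_ne_zero (mul_ne_zero hκ (pow_ne_zero _ (mul_ne_zero hF hrh))) (pow_ne_zero _ hb)
  have hne' := left_ne_zero_of_mul (left_ne_zero_of_mul hne)
  have hA0 := left_ne_zero_of_mul hne'
  have hAC := right_ne_zero_of_mul hne'
  have hC0 : M * b ^ (D + 1) ≠ 0 := mul_ne_zero hM (pow_ne_zero _ hb)
  have hbF : b * F ≠ 0 := mul_ne_zero hb hF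
  have hx0 : M * κ * ρ ≠ 0 := mul_ne_zero (mul_ne_zero hM hκ) hrh
  have hmain := abc_coprime_quotient hε hK habcK hA0 hC0 (sub_ne_zero.mp hAC) hG0
    (mul_ne_zero hx0 hbF)
    (fun g hgA hgC => dvd_of_dvd_homEval hab hgA hgC) (fun ℓ hℓ hd => by
      have hℓ' : Prime (ℓ : ℤ) := Nat.prime_iff_prime_int.mp hℓ
      rcases hℓ'.dvd_mul.mp hd with hd | hd
      · have h1 : (ℓ : ℤ) ∣ κ * (F * ρ) ^ n * b ^ (2 * (D + 1) + u.natDegree) := by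
          rw [← hident, mul_assoc]
          exact hd.mul_right _
        rcases hℓ'.dvd_mul.mp h1 with h1 | h1
        · rcases hℓ'.dvd_mul.mp h1 with h1 | h1
          · exact h1.trans ⟨M * ρ * (b * F), by ring⟩
          · exact (hℓ'.dvd_of_dvd_pow h1).trans ⟨M * κ * b, by ring⟩
        · exact (hℓ'.dvd_of_dvd_pow h1).trans ⟨M * κ * ρ * F, by ring⟩
      · rcases hℓ'.dvd_mul.mp hd with h1 | h1
        · exact h1.trans ⟨κ * ρ * (b * F), by ring⟩
        · exact (hℓ'.dvd_of_dvd_pow h1).trans ⟨M * κ * ρ * F, by ring⟩)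
  have hrad : (IntRadical (M * κ * ρ * (b * F)) : ℝ) ≤
      T * (IntRadical (b * F) * H ^ (r.natDegree : ℝ)) := by
    have h1 : (IntRadical (M * κ * ρ * (b * F)) : ℝ) ≤
        |((M * κ * ρ : ℤ) : ℝ)| * IntRadical (b * F) := by
      have h2 := intRadical_mul_le hx0 hbF
      have h3 : (((M * κ * ρ).natAbs : ℕ) : ℝ) = |((M * κ * ρ : ℤ) : ℝ)| := by
        rw [Nat.cast_natAbs, Int.cast_abs]
      rw [← h3]
      exact_mod_cast h2
    refine h1.trans ?_
    rw [Int.cast_mul _ ρ, abs_mul, hT, Real.rpow_natCast]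
    have h4 : |(ρ : ℝ)| ≤ S * H ^ r.natDegree := hS a b
    calc |((M * κ : ℤ) : ℝ)| * |(ρ : ℝ)| * (IntRadical (b * F) : ℝ)
        ≤ |((M * κ : ℤ) : ℝ)| * (S * H ^ r.natDegree) * (IntRadical (b * F) : ℝ) := by gcongr
      _ = _ := by ring
  have hbC : |(b : ℝ)| ^ (D + 1) ≤ |((M * b ^ (D + 1) : ℤ) : ℝ)| := by
    push_cast
    rw [abs_mul, abs_pow]
    exact le_mul_of_one_le_left (by positivity) (by exact_mod_cast Int.one_le_abs hM)
  have hpowle : H ^ (D + 1) ≤ c₀ * (|(G : ℝ)| * (K * T ^ (1 + ε))) *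
      (IntRadical (b * F) * H ^ (r.natDegree : ℝ)) ^ (1 + ε) := by
    calc H ^ (D + 1) ≤ c₀ * max |(A : ℝ)| (|(b : ℝ)| ^ (D + 1)) := hgrow a b
      _ ≤ c₀ * (|(G : ℝ)| * (K * (IntRadical (M * κ * ρ * (b * F)) : ℝ) ^ (1 + ε))) := by
        gcongr
        exact (max_le_max_left _ hbC).trans hmain
      _ ≤ c₀ * (|(G : ℝ)| * (K *
          (T * (IntRadical (b * F) * H ^ (r.natDegree : ℝ))) ^ (1 + ε))) := by gcongr
      _ = _ := by
        rw [Real.mul_rpow hTpos.le (by positivity)]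
        ring
  have hres := hfin H _ hH1 (by linarith) hpowle
  have hexp : ((D + 1 : ℕ) : ℝ) - r.natDegree - δ = (N : ℝ) - 1 - δ := by
    have : (N : ℝ) + r.natDegree = (D + 1 : ℕ) + 1 := by exact_mod_cast hdeg
    linarith
  rw [Nat.succ_eq_add_one, hexp] at hres
  refine le_trans ?_ hres
  gcongr
  exact min_le_left _ _

theorem NthPowerFree.factorization_lt {n : ℕ} (hn : n ≠ 0) {d : ℤ} (hd : NthPowerFree n d)
    (p : ℕ) : d.natAbs.factorization p < n := by
  by_cases hp : p.Prime
  · by_contra! h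
    have h1 := (hp.pow_dvd_iff_le_factorization (Int.natAbs_ne_zero.mpr hd.1)).mpr h
    exact hd.2 p hp (by exact_mod_cast Int.natCast_dvd.mpr h1)
  · rw [Nat.factorization_eq_zero_of_not_prime _ hp]
    omega

theorem NthPowerFree.natAbs_eq {n : ℕ} (hn : n ≠ 0) {d d' w w' : ℤ} (hd : NthPowerFree n d)
    (hd' : NthPowerFree n d') (hw : w ≠ 0) (hw' : w' ≠ 0) (h : d * w ^ n = d' * w' ^ n) :
    d.natAbs = d'.natAbs := by
  refine Nat.eq_of_factorization_eq (Int.natAbs_ne_zero.mpr hd.1) (Int.natAbs_ne_zero.mpr hd'.1)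
    fun p => ?_
  have h1 := congrArg (fun z : ℤ => z.natAbs.factorization p) h
  simp only [Int.natAbs_mul, Int.natAbs_pow] at h1
  rw [Nat.factorization_mul (Int.natAbs_ne_zero.mpr hd.1)
      (pow_ne_zero _ (Int.natAbs_ne_zero.mpr hw)),
    Nat.factorization_mul (Int.natAbs_ne_zero.mpr hd'.1)
      (pow_ne_zero _ (Int.natAbs_ne_zero.mpr hw')), Nat.factorization_pow,
    Nat.factorization_pow] at h1
  simp only [Finsupp.add_apply, Finsupp.smul_apply, smul_eq_mul] at h1
  have h2 := congrArg (· % n) h1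
  simpa [Nat.add_mul_mod_self_left, Nat.mod_eq_of_lt (hd.factorization_lt hn p),
    Nat.mod_eq_of_lt (hd'.factorization_lt hn p)] using h2

theorem NthPowerFree.exists_int_of_rat {n : ℕ} {d G : ℤ} (hd : NthPowerFree n d)
    {w : ℚ} (h : (d : ℚ) * w ^ n = G) : ∃ w' : ℤ, w = w' := by
  refine ⟨w.num, ?_⟩
  have hden : (w.den : ℚ) ≠ 0 := by exact_mod_cast w.den_ne_zero
  have h1 : d * w.num ^ n = G * (w.den : ℤ) ^ n := by
    have h2 : (d : ℚ) * (w.num : ℚ) ^ n = G * (w.den : ℚ) ^ n := by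
      rw [← h, ← Rat.mul_den_eq_num w]; ring
    exact_mod_cast h2
  have hcop : IsCoprime ((w.den : ℤ) ^ n) (w.num ^ n) :=
    (Int.isCoprime_iff_gcd_eq_one.mpr (by
      rw [Int.gcd_comm]; exact w.reduced)).pow
  have h3 : (w.den : ℤ) ^ n ∣ d := hcop.dvd_of_dvd_mul_right ⟨G, by rw [h1, mul_comm]⟩
  have h4 : w.den = 1 := by
    by_contra hne
    obtain ⟨p, hp, hpd⟩ := Nat.exists_prime_and_dvd hne
    exact hd.2 p hp ((pow_dvd_pow_of_dvd (Int.natCast_dvd_natCast.mpr hpd) n).trans h3)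
  rw [← Rat.mul_den_eq_num w, h4]
  simp

theorem exists_twist_value {n k i : ℕ} (hin : i ≤ n) {f : ℤ[X]}
    (hdeg : f.natDegree = n * k + i) {d : ℤ} (hd : NthPowerFree n d) {x y : ℚ} (hy : y ≠ 0)
    (hxy : (d : ℚ) * y ^ n = aeval x f) :
    ∃ w : ℤ, w ≠ 0 ∧
      d * w ^ n = (x.den : ℤ) ^ (n - i) * homEval f f.natDegree x.num x.den := by
  have hb : (x.den : ℤ) ≠ 0 := by exact_mod_cast x.den_ne_zero
  have hb' : (x.den : ℚ) ≠ 0 := by exact_mod_cast x.den_ne_zero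
  have h1 : (d : ℚ) * (y * (x.den : ℚ) ^ (k + 1)) ^ n =
      (((x.den : ℤ) ^ (n - i) * homEval f f.natDegree x.num x.den : ℤ) : ℚ) := by
    rw [Int.cast_mul, cast_homEval le_rfl hb, Int.cast_natCast, Rat.num_div_den, ← hxy, hdeg]
    have h2 : (k + 1) * n = (n - i) + (n * k + i) := by
      rw [add_mul, mul_comm k n]; omega
    rw [mul_pow, ← pow_mul, h2, pow_add]
    push_cast
    ring
  obtain ⟨w, hw⟩ := hd.exists_int_of_rat h1
  refine ⟨w, ?_, ?_⟩
  · rintro rfl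
    rw [Int.cast_zero] at hw
    exact mul_ne_zero hy (pow_ne_zero _ hb') hw
  · rw [hw] at h1
    exact_mod_cast h1

theorem le_of_valuation_eq {n i t m s φ : ℕ} (hn : 2 ≤ n) (hi : 1 ≤ i) (hin : i ≤ n)
    (h : t + n * m = (n - i) * s + φ) (hs : s = 0 ∧ φ ≠ 0 ∨ s ≠ 0 ∧ φ = 0) :
    n ≤ (n - 1) * t + n.gcd i * s + φ := by
  have hg : 1 ≤ n.gcd i := Nat.gcd_pos_of_pos_right _ hi
  rcases Nat.eq_zero_or_pos t with rfl | ht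
  · rcases hs with ⟨rfl, hφ⟩ | ⟨hs, rfl⟩
    · have hm : 1 ≤ m := by
        by_contra hm
        obtain rfl : m = 0 := by omega
        simp at h
        omega
      nlinarith
    · have h1 : n ∣ i * s := by
        refine ⟨s - m, ?_⟩
        have h2 : n * m + i * s = n * s := by
          have : (n - i) * s + i * s = n * s := by rw [← add_mul]; congr; omega
          omega
        rw [Nat.mul_sub]
        omega
      have h3 : n ∣ n.gcd i * s := by
        rw [← Nat.gcd_mul_right]
        exact Nat.dvd_gcd (dvd_mul_right _ _) h1
      have h4 := Nat.le_of_dvd (Nat.mul_pos hg (Nat.pos_of_ne_zero hs)) h3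
      omega
  · have h1 : n - 1 ≤ (n - 1) * t := Nat.le_mul_of_pos_right _ ht
    rcases hs with ⟨rfl, hφ⟩ | ⟨hs, rfl⟩
    · omega
    · have : 1 ≤ n.gcd i * s := Nat.mul_pos hg (Nat.pos_of_ne_zero hs)
      omega

theorem intRadical_pow_dvd {m : ℤ} {n Z : ℕ}
    (h : ∀ p : ℕ, p.Prime → (p : ℤ) ∣ m → p ^ n ∣ Z) : IntRadical m ^ n ∣ Z := by
  rw [IntRadical, ← Finset.prod_pow]
  refine Finset.prod_dvd_of_isRelPrime (fun p hp q hq hpq => ?_) fun p hp => ?_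
  · exact Nat.coprime_iff_isRelPrime.mp (Nat.Coprime.pow _ _
      ((Nat.coprime_primes (Nat.prime_of_mem_primeFactors hp)
        (Nat.prime_of_mem_primeFactors hq)).mpr hpq))
  · exact h p (Nat.prime_of_mem_primeFactors hp)
      (Int.natCast_dvd.mpr (Nat.dvd_of_mem_primeFactors hp))

theorem intRadical_pow_le {n i : ℕ} (hn : 2 ≤ n) (hi : 1 ≤ i) (hin : i ≤ n) {f : ℤ[X]} {N : ℕ}
    (hl : f.coeff (N + 1) ≠ 0) {a b d w : ℤ} (hab : IsCoprime a b) (hb : b ≠ 0)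
    (hd : NthPowerFree n d) (hw : w ≠ 0)
    (h : d * w ^ n = b ^ (n - i) * homEval f (N + 1) a b) :
    IntRadical (b * homEval f (N + 1) a b) ^ n ≤ (f.coeff (N + 1)).natAbs ^ n *
      (d.natAbs ^ (n - 1) * b.natAbs ^ n.gcd i * (homEval f (N + 1) a b).natAbs) := by
  have hsucc := homEval_succ f N a b
  set F := homEval f (N + 1) a b
  set l := f.coeff (N + 1)
  have hF : F ≠ 0 := by
    intro h0
    rw [h0, mul_zero] at h
    exact mul_ne_zero hd.1 (pow_ne_zero _ hw) h
  have hl' := Int.natAbs_ne_zero.mpr hl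
  have hb' := Int.natAbs_ne_zero.mpr hb
  have hd' := Int.natAbs_ne_zero.mpr hd.1
  have hw' := Int.natAbs_ne_zero.mpr hw
  have hF' := Int.natAbs_ne_zero.mpr hF
  refine Nat.le_of_dvd (by positivity) (intRadical_pow_dvd fun p hp hpd => ?_)
  by_cases hpl : (p : ℤ) ∣ l
  · exact (pow_dvd_pow_of_dvd (Int.natCast_dvd.mp hpl) n).mul_right _
  refine Dvd.dvd.mul_left ?_ _
  have hp' : Prime (p : ℤ) := Nat.prime_iff_prime_int.mp hp
  have hnot : ¬ ((p : ℤ) ∣ b ∧ (p : ℤ) ∣ F) := by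
    rintro ⟨h1, h2⟩
    rw [hsucc, dvd_add_left (h1.mul_right _)] at h2
    have h3 := hp'.dvd_of_dvd_pow ((hp'.dvd_mul.mp h2).resolve_left hpl)
    exact hp'.not_isUnit (hab.isUnit_of_dvd' h3 h1)
  have hval := congrArg (fun z : ℤ => z.natAbs.factorization p) h
  simp only [Int.natAbs_mul, Int.natAbs_pow] at hval
  rw [Nat.factorization_mul hd' (pow_ne_zero _ hw'), Nat.factorization_mul (pow_ne_zero _ hb') hF',
    Nat.factorization_pow, Nat.factorization_pow] at hval
  simp only [Finsupp.add_apply, Finsupp.smul_apply, smul_eq_mul] at hval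
  rw [hp.pow_dvd_iff_le_factorization (by positivity), Nat.factorization_mul (by positivity) hF',
    Nat.factorization_mul (by positivity) (by positivity), Nat.factorization_pow,
    Nat.factorization_pow]
  simp only [Finsupp.add_apply, Finsupp.smul_apply, smul_eq_mul]
  refine le_of_valuation_eq hn hi hin hval ?_
  have hdvd : ∀ z : ℤ, z ≠ 0 → (z.natAbs.factorization p ≠ 0 ↔ (p : ℤ) ∣ z) := fun z hz => by
    rw [Int.natCast_dvd, ← Nat.pos_iff_ne_zero,
      hp.dvd_iff_one_le_factorization (Int.natAbs_ne_zero.mpr hz), Nat.succ_le_iff]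
  have h1 := hdvd b hb
  have h2 := hdvd F hF
  rcases hp'.dvd_mul.mp hpd with h3 | h3 <;> tauto

theorem ncard_le_of_nthPowerFree {n : ℕ} (hn : n ≠ 0) (G : ℤ → ℤ → ℤ) (B : ℕ) {T : Set ℤ}
    (hT : ∀ d ∈ T, NthPowerFree n d ∧ ∃ a b w : ℤ, |a| ≤ B ∧ |b| ≤ B ∧ w ≠ 0 ∧
      d * w ^ n = G a b) : T.ncard ≤ 2 * (2 * B + 1) ^ 2 := by
  classical
  choose! hfree a b w ha hb hw hG using hT
  let J : Finset ℤ := Finset.Icc (-(B : ℤ)) B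
  have hJ : J.card = 2 * B + 1 := by
    rw [Int.card_Icc]; omega
  let V : Finset (Bool × ℤ × ℤ) := Finset.univ ×ˢ (J ×ˢ J)
  have hV : V.card = 2 * (2 * B + 1) ^ 2 := by
    rw [Finset.card_product, Finset.card_product, hJ, Finset.card_univ, Fintype.card_bool, sq]
  rw [← hV, ← Set.ncard_coe_finset]
  refine Set.ncard_le_ncard_of_injOn (fun d => (decide (0 ≤ d), a d, b d)) (fun d hd => ?_)
    (fun d hd d' hd' h => ?_) V.finite_toSet
  · have h1 := abs_le.mp (ha d hd)
    have h2 := abs_le.mp (hb d hd)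
    exact Finset.mem_coe.mpr (Finset.mem_product.mpr ⟨Finset.mem_univ _,
      Finset.mem_product.mpr ⟨Finset.mem_Icc.mpr h1, Finset.mem_Icc.mpr h2⟩⟩)
  · simp only [Prod.mk.injEq, decide_eq_decide] at h
    have h1 := (hfree d hd).natAbs_eq hn (hfree d' hd') (hw d hd) (hw d' hd')
      (by rw [hG d hd, hG d' hd', h.2.1, h.2.2])
    omega

theorem le_mul_rpow_of_rpow_le {n : ℕ} (hn : 2 ≤ n) {e ε : ℝ} (he : 0 < e) (hε : 0 < ε) :
    ∃ δ : ℝ, 0 < δ ∧ ∀ C : ℝ, 1 ≤ C → ∃ C' : ℝ, 1 ≤ C' ∧ ∀ H X : ℝ, 1 ≤ H → 1 ≤ X →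
      H ^ ((n - 1 : ℝ) * e - n * δ) ≤ C * X ^ (n - 1 : ℝ) →
      H ≤ C' * X ^ ((2 / e + ε) / 2) := by
  have hn' : (2 : ℝ) ≤ n := by exact_mod_cast hn
  have hn1 : (0 : ℝ) < n - 1 := by linarith
  have hn0 : (0 : ℝ) < n := by linarith
  set θ := 2 / (2 / e + ε) with hθ
  have hθ0 : 0 < θ := by positivity
  have hθe : θ < e := by
    rw [hθ, div_lt_iff₀ (by positivity), mul_add, mul_div_cancel₀ _ he.ne']
    linarith [mul_pos he hε]
  have hexp : (n - 1 : ℝ) * e - n * ((n - 1) * (e - θ) / n) = (n - 1) * θ := by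
    field_simp; ring
  refine ⟨(n - 1) * (e - θ) / n, div_pos (mul_pos hn1 (by linarith)) hn0, fun C hC => ⟨
    C ^ ((n - 1) * θ)⁻¹, Real.one_le_rpow hC (by positivity), fun H X hH hX h => ?_⟩⟩
  rw [hexp] at h
  have h1 := Real.rpow_le_rpow (by positivity) h (z := ((n - 1) * θ)⁻¹) (by positivity)
  rw [← Real.rpow_mul (by linarith), mul_inv_cancel₀ (by positivity), Real.rpow_one,
    Real.mul_rpow (by linarith) (by positivity), ← Real.rpow_mul (by linarith)] at h1
  have h2 : (n - 1 : ℝ) * ((n - 1) * θ)⁻¹ = (2 / e + ε) / 2 := by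
    rw [mul_inv, ← mul_assoc, mul_inv_cancel₀ hn1.ne', one_mul, hθ, inv_div]
  rwa [h2] at h1

/-- Assuming the abc conjecture, the number of `n`-th power free `d` with
`|d| ≤ X` whose twist has a nontrivial rational point is `≪ X^{2/e+ε}`. -/
theorem stmt_2 (habc : ABCConjecture) (n : ℕ) (hn : 2 ≤ n) (f : Polynomial ℤ)
    (hsf : Squarefree (f.map (Int.castRingHom ℚ)))
    (k i : ℕ) (hi1 : 1 ≤ i) (hin : i ≤ n) (hdeg : f.natDegree = n * k + i)
    (e : ℝ)
    (he : e = ((n : ℝ) * k + i - 1) - ((Nat.gcd n i : ℝ) + 1) / ((n : ℝ) - 1))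
    (hepos : 0 < e) :
    ∀ ε : ℝ, 0 < ε → ∃ K : ℝ, 0 < K ∧ ∀ X : ℝ, 2 ≤ X →
      ({d : ℤ | |(d : ℝ)| ≤ X ∧ NthPowerFree n d ∧
          ∃ x y : ℚ, y ≠ 0 ∧ (d : ℚ) * y ^ n = Polynomial.aeval x f}.ncard : ℝ)
        ≤ K * X ^ (2 / e + ε) := by
  intro ε hε
  obtain ⟨N, hN⟩ : ∃ N, f.natDegree = N + 1 := ⟨n * k + i - 1, by omega⟩
  have hl : f.coeff (N + 1) ≠ 0 := by
    rw [← hN, coeff_natDegree, Ne, leadingCoeff_eq_zero]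
    rintro rfl
    simp at hN
  have hn' : (2 : ℝ) ≤ n := by exact_mod_cast hn
  have hn1 : (n : ℝ) - 1 ≠ 0 := by linarith
  have hcast : ((n - 1 : ℕ) : ℝ) = n - 1 := by rw [Nat.cast_sub (by omega), Nat.cast_one]
  obtain ⟨δ, hδ, hfin⟩ := le_mul_rpow_of_rpow_le hn hepos hε
  obtain ⟨c, hc, hrad⟩ := habc.le_intRadical_homEval hsf hδ
  obtain ⟨S, hS1, hS⟩ := abs_homEval_le f (N + 1)
  obtain ⟨C', hC', hH⟩ := hfin (max 1 (|(f.coeff (N + 1) : ℝ)| ^ n * S / c ^ n))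
    (le_max_left _ _)
  refine ⟨18 * C' ^ 2, by positivity, fun X hX => ?_⟩
  set Y : ℝ := C' * X ^ ((2 / e + ε) / 2) with hY
  have hY1 : 1 ≤ Y := one_le_mul_of_one_le_of_one_le hC'
    (Real.one_le_rpow (by linarith) (by positivity))
  have hbound : ∀ d : ℤ, |(d : ℝ)| ≤ X → NthPowerFree n d → ∀ x y : ℚ, y ≠ 0 →
      (d : ℚ) * y ^ n = aeval x f → max |(x.num : ℝ)| |((x.den : ℤ) : ℝ)| ≤ Y := by
    intro d hdX hd x y hy hxy
    obtain ⟨w, hw, hwd⟩ := exists_twist_value hin hdeg hd hy hxy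
    have hb : (x.den : ℤ) ≠ 0 := by exact_mod_cast x.den_ne_zero
    have hab : IsCoprime x.num (x.den : ℤ) := Int.isCoprime_iff_gcd_eq_one.mpr x.reduced
    rw [hN] at hwd hrad
    have h1 := intRadical_pow_le hn hi1 hin hl hab hb hd hw hwd
    have hF : homEval f (N + 1) x.num x.den ≠ 0 := by
      intro h0
      rw [h0, mul_zero] at hwd
      exact mul_ne_zero hd.1 (pow_ne_zero _ hw) hwd
    have h2 := hrad _ _ hab hb hF
    have h3 := hS x.num x.den
    generalize (x.den : ℤ) = b at *
    generalize x.num = a at *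
    set F := homEval f (N + 1) a b
    set H := max |(a : ℝ)| |(b : ℝ)| with hHdef
    have hH1 : 1 ≤ H := le_max_of_le_right (by exact_mod_cast Int.one_le_abs hb)
    have hH0 : 0 < H := by linarith
    refine hH H X hH1 (by linarith) ?_
    have h4 : (IntRadical (b * F) : ℝ) ^ n ≤ |(f.coeff (N + 1) : ℝ)| ^ n *
        (|(d : ℝ)| ^ (n - 1) * |(b : ℝ)| ^ n.gcd i * |(F : ℝ)|) := by
      have h5 : ((IntRadical (b * F) ^ n : ℕ) : ℝ) ≤ _ := Nat.cast_le.mpr h1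
      push_cast [Nat.cast_natAbs] at h5
      exact h5
    have h6 : c ^ n * (H ^ (((N + 1 : ℕ) : ℝ) - 1 - δ)) ^ n ≤
        |(f.coeff (N + 1) : ℝ)| ^ n * (X ^ (n - 1) * H ^ n.gcd i * (S * H ^ (N + 1))) := by
      rw [← mul_pow]
      refine (pow_le_pow_left₀ (by positivity) h2 n).trans (h4.trans ?_)
      gcongr
      exact le_max_right _ _
    have hexp : (n - 1 : ℝ) * e - n * δ =
        (((N + 1 : ℕ) : ℝ) - 1 - δ) * n - (n.gcd i + (N + 1) : ℕ) := by
      have h7 : (n : ℝ) * k + i = N + 1 := by exact_mod_cast hdeg.symm.trans hN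
      rw [he, h7]
      push_cast
      field_simp
      ring
    rw [hexp, Real.rpow_sub hH0, Real.rpow_natCast, Real.rpow_mul hH0.le, Real.rpow_natCast,
      div_le_iff₀ (by positivity), ← hcast, Real.rpow_natCast]
    calc (H ^ (((N + 1 : ℕ) : ℝ) - 1 - δ)) ^ n
        ≤ |(f.coeff (N + 1) : ℝ)| ^ n * (X ^ (n - 1) * H ^ n.gcd i * (S * H ^ (N + 1))) /
          c ^ n := by rwa [le_div_iff₀' (by positivity)]
      _ = |(f.coeff (N + 1) : ℝ)| ^ n * S / c ^ n * X ^ (n - 1) * H ^ (n.gcd i + (N + 1)) := by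
        rw [pow_add]; ring
      _ ≤ _ := by
        gcongr
        exact le_max_right _ _
  have hcount := ncard_le_of_nthPowerFree (n := n) (by omega)
    (fun a b => b ^ (n - i) * homEval f f.natDegree a b) ⌊Y⌋₊
    (T := {d : ℤ | |(d : ℝ)| ≤ X ∧ NthPowerFree n d ∧
      ∃ x y : ℚ, y ≠ 0 ∧ (d : ℚ) * y ^ n = Polynomial.aeval x f}) (by
    rintro d ⟨hdX, hd, x, y, hy, hxy⟩
    obtain ⟨w, hw, hwd⟩ := exists_twist_value hin hdeg hd hy hxy
    have h1 := hbound d hdX hd x y hy hxy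
    have hfloor : ∀ z : ℤ, |(z : ℝ)| ≤ Y → |z| ≤ (⌊Y⌋₊ : ℤ) := fun z hz => by
      rw [Int.natCast_floor_eq_floor (by linarith), Int.le_floor]
      exact_mod_cast hz
    exact ⟨hd, x.num, x.den, w, hfloor _ ((le_max_left _ _).trans h1),
      hfloor _ ((le_max_right _ _).trans h1), hw, hwd⟩)
  have hcount' : _ ≤ ((2 * (2 * ⌊Y⌋₊ + 1) ^ 2 : ℕ) : ℝ) := Nat.cast_le.mpr hcount
  refine hcount'.trans ?_
  have hfl : (⌊Y⌋₊ : ℝ) ≤ Y := Nat.floor_le (by linarith)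
  have hsq : (X ^ ((2 / e + ε) / 2)) ^ 2 = X ^ (2 / e + ε) := by
    rw [← Real.rpow_natCast, ← Real.rpow_mul (by linarith)]
    norm_num
  push_cast
  calc 2 * (2 * (⌊Y⌋₊ : ℝ) + 1) ^ 2 ≤ 2 * (2 * Y + Y) ^ 2 := by gcongr
    _ = 18 * C' ^ 2 * X ^ (2 / e + ε) := by rw [← hsq, hY]; ring
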